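/- arXiv:1711.10395 — 3 statements merged into one kernel-verified Lean document; each statement's English description precedes it below -/
import Mathlib

section
/- Let K be a nonmetrizable compact Hausdorff space. Then there exist a family of continuous functions f_α : K → [0,1] and points x_α^0, x_α^1 ∈ K, indexed by α < ω₁, such that f_α(x_α^i) = i for every α < ω₁ and i ∈ {0,1}, and f_β(x_α^0) = f_β(x_α^1) for all β < α < ω₁. -/
open Cardinal in
/-- Every proper initial segment of `ω₁` is countable. -/
theorem countable_Iio_of_lt_ord_aleph_one {o : Ordinal} (ho : o < (aleph 1).ord) :
    (Set.Iio o).Countable := by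
  rw [← Set.countable_coe_iff, ← mk_le_aleph0_iff, mk_Iio_ordinal, lift_le_aleph0,
    ← Order.lt_succ_iff, succ_aleph0]
  exact lt_ord.1 ho

/-- A compact space whose points are separated by countably many continuous real-valued functions
is metrizable. -/
theorem metrizableSpace_of_countable_separating {K : Type*} [TopologicalSpace K] [CompactSpace K]
    {S : Set C(K, ℝ)} (hS : S.Countable) (hsep : ∀ p q : K, (∀ g ∈ S, g p = g q) → p = q) :
    TopologicalSpace.MetrizableSpace K := by
  have : Countable S := hS.to_subtype
  have hc : Continuous fun (y : K) (g : S) => g.1 y := by fun_prop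
  refine (hc.isClosedEmbedding fun p q hpq => ?_).isEmbedding.metrizableSpace
  exact hsep p q fun g hg => congrFun hpq ⟨g, hg⟩

/-- In a nonmetrizable compact Hausdorff space, some pair of points is not separated by a given
countable family of continuous functions, but is by a continuous function to `[0, 1]`. -/
theorem exists_continuousMap_of_countable {K : Type*} [TopologicalSpace K] [CompactSpace K]
    [T2Space K] (hK : ¬ TopologicalSpace.MetrizableSpace K) {S : Set C(K, ℝ)}
    (hS : S.Countable) :
    ∃ t : C(K, ℝ) × (Bool → K), (∀ y, t.1 y ∈ Set.Icc (0 : ℝ) 1) ∧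
      (∀ i : Bool, t.1 (t.2 i) = if i then 1 else 0) ∧
      ∀ g ∈ S, g (t.2 false) = g (t.2 true) := by
  obtain ⟨p, q, hpq, hne⟩ : ∃ p q : K, (∀ g ∈ S, g p = g q) ∧ p ≠ q := by
    by_contra! h
    exact hK (metrizableSpace_of_countable_separating hS h)
  obtain ⟨f, hf0, hf1, hf⟩ := exists_continuous_zero_one_of_isClosed (isClosed_singleton (x := p))
    (isClosed_singleton (x := q)) (Set.disjoint_singleton.2 hne)
  refine ⟨(f, fun i => if i then q else p), hf, ?_, by simpa using hpq⟩
  rintro (_ | _)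
  · simpa using hf0 rfl
  · simpa using hf1 rfl

open Cardinal in
/-- For every nonmetrizable compact Hausdorff space `K` there are continuous functions
`f_α : K → [0,1]` and points `x_α^0, x_α^1 ∈ K` indexed by `α < ω₁` with
`f_α (x_α^i) = i` and `f_β (x_α^0) = f_β (x_α^1)` for all `β < α < ω₁`. -/
theorem stmt10 (K : Type*) [TopologicalSpace K] [CompactSpace K] [T2Space K]
    (hK : ¬ TopologicalSpace.MetrizableSpace K) :
    ∃ (f : {o : Ordinal // o < (aleph 1).ord} → C(K, ℝ))
      (x : {o : Ordinal // o < (aleph 1).ord} → Bool → K),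
      (∀ α, ∀ y : K, f α y ∈ Set.Icc (0 : ℝ) 1) ∧
      (∀ α, ∀ i : Bool, f α (x α i) = if i then 1 else 0) ∧
      (∀ α β : {o : Ordinal // o < (aleph 1).ord}, β.1 < α.1 →
        f β (x α false) = f β (x α true)) := by
  choose step hstep using fun (S : Set C(K, ℝ)) (hS : S.Countable) =>
    exists_continuousMap_of_countable hK hS
  have hcount (α : {o : Ordinal // o < (aleph 1).ord}) : Countable (Set.Iio α) :=
    ((countable_Iio_of_lt_ord_aleph_one α.2).preimage Subtype.val_injective).to_subtype
  let F : {o : Ordinal // o < (aleph 1).ord} → C(K, ℝ) × (Bool → K) :=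
    wellFounded_lt.fix fun α ih =>
      step (Set.range fun β : Set.Iio α => (ih β.1 β.2).1) (Set.countable_range _)
  have hF (α) : F α = step (Set.range fun β : Set.Iio α => (F β).1) (Set.countable_range _) :=
    wellFounded_lt.fix_eq _ α
  have hFstep (α) := hF α ▸ hstep (Set.range fun β : Set.Iio α => (F β).1) (Set.countable_range _)
  exact ⟨fun α => (F α).1, fun α => (F α).2, fun α => (hFstep α).1, fun α => (hFstep α).2.1,
    fun α β h => (hFstep α).2.2 _ ⟨⟨β, h⟩, rfl⟩⟩
end

section
/- Let d ≥ 1. If L1,...,Ld are compact linearly ordered topological spaces and there is a continuous surjection from L1 × ... × Ld onto K1 × K2 × ... × K_{d+1}, where all K_i are infinite compact Hausdorff spaces, then there exist indices 1 ≤ i < j ≤ d+1 such that K_i and K_j are metrizable. -/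
section Cuts

variable {ι : Type*} {L : ι → Type*} [∀ l, LinearOrder (L l)]

/-- The relation `r` holds between points of a product of lines that cannot be distinguished
by some partition of each line into at most `B + 1` intervals (given as the fibres of a
monotone function). -/
def ResolvedBy (r : (∀ l, L l) → (∀ l, L l) → Prop) (B : ℕ) : Prop :=
  ∃ φ : ∀ l, L l → ℕ, (∀ l, Monotone (φ l)) ∧ (∀ l x, φ l x ≤ B) ∧
    ∀ p q : ∀ l, L l, (∀ l, φ l (p l) = φ l (q l)) → r p q

theorem ResolvedBy.mono {r s : (∀ l, L l) → (∀ l, L l) → Prop} {B C : ℕ}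
    (h : ResolvedBy r B) (hrs : ∀ p q, r p q → s p q) (hBC : B ≤ C) : ResolvedBy s C := by
  obtain ⟨φ, hm, hb, hr⟩ := h
  exact ⟨φ, hm, fun l x => (hb l x).trans hBC, fun p q h => hrs p q (hr p q h)⟩

theorem Monotone.eq_of_sum_eq {X α : Type*} [LinearOrder X] {A : Finset α} {φ : α → X → ℕ}
    (hφ : ∀ a ∈ A, Monotone (φ a)) {x y : X}
    (h : ∑ a ∈ A, φ a x = ∑ a ∈ A, φ a y) {a : α} (ha : a ∈ A) : φ a x = φ a y := by
  rcases le_total x y with hxy | hxy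
  · exact (Finset.sum_eq_sum_iff_of_le fun b hb => hφ b hb hxy).1 h a ha
  · exact ((Finset.sum_eq_sum_iff_of_le fun b hb => hφ b hb hxy).1 h.symm a ha).symm

/-- Finitely many interval partitions have a common refinement with controlled size. -/
theorem ResolvedBy.forall_mem {α : Type*} (A : Finset α)
    {r : α → (∀ l, L l) → (∀ l, L l) → Prop} {B : α → ℕ}
    (h : ∀ a ∈ A, ResolvedBy (r a) (B a)) :
    ResolvedBy (fun p q => ∀ a ∈ A, r a p q) (∑ a ∈ A, B a) := by
  have h' : ∀ a, ∃ φ : ∀ l, L l → ℕ, a ∈ A → (∀ l, Monotone (φ l)) ∧ (∀ l x, φ l x ≤ B a) ∧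
      ∀ p q : ∀ l, L l, (∀ l, φ l (p l) = φ l (q l)) → r a p q := fun a => by
    by_cases ha : a ∈ A
    · obtain ⟨φ, hφ⟩ := h a ha
      exact ⟨φ, fun _ => hφ⟩
    · exact ⟨fun _ _ => 0, fun hh => absurd hh ha⟩
  choose φ hφ using h'
  refine ⟨fun l x => ∑ a ∈ A, φ a l x, fun l x y hxy => ?_, fun l x => ?_, fun p q hpq a ha => ?_⟩
  · exact Finset.sum_le_sum fun a ha => (hφ a ha).1 l hxy
  · exact Finset.sum_le_sum fun a ha => (hφ a ha).2.1 l x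
  · exact (hφ a ha).2.2 p q fun l =>
      Monotone.eq_of_sum_eq (φ := fun a => φ a l) (fun b hb => (hφ b hb).1 l) (hpq l) ha

theorem ResolvedBy.card_le [Fintype ι] {r : (∀ l, L l) → (∀ l, L l) → Prop} {B : ℕ}
    (h : ResolvedBy r B) {κ : Type*} [Fintype κ] (u : κ → ∀ l, L l)
    (hu : ∀ a b, r (u a) (u b) → a = b) : Fintype.card κ ≤ (B + 1) ^ Fintype.card ι := by
  classical
  obtain ⟨φ, -, hb, hr⟩ := h
  let ψ : κ → ι → Fin (B + 1) := fun a l => ⟨φ l (u a l), Nat.lt_succ_of_le (hb l _)⟩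
  have hψ : Function.Injective ψ := fun a b hab =>
    hu a b <| hr _ _ fun l => congrArg Fin.val (congrFun hab l)
  simpa using Fintype.card_le_of_injective ψ hψ

/-- Membership in a box with closed interval sides is resolved by two cuts of each line. -/
theorem resolvedBy_mem_box (b c : ∀ l, L l) :
    ResolvedBy (fun p q : ∀ l, L l =>
      (∀ l, p l ∈ Set.Icc (b l) (c l)) → ∀ l, q l ∈ Set.Icc (b l) (c l)) 2 := by
  refine ⟨fun l x => (if b l ≤ x then 1 else 0) + (if c l < x then 1 else 0),
    fun l x y hxy => ?_, fun l x => ?_, fun p q hpq hp l => ?_⟩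
  · refine add_le_add ?_ ?_
    · by_cases h : b l ≤ x
      · simp [h, h.trans hxy]
      · simp [h]
    · by_cases h : c l < x
      · simp [h, h.trans_le hxy]
      · simp [h]
  · dsimp only
    split_ifs <;> simp
  · have h1 := hpq l
    obtain ⟨h2, h3⟩ := hp l
    by_cases hb : b l ≤ q l <;> by_cases hc : c l < q l
    · simp [h2, h3.not_gt, hb, hc] at h1
    · exact ⟨hb, not_lt.1 hc⟩
    · exact absurd (h2.trans (h3.trans hc.le)) hb
    · simp [h2, h3.not_gt, hb, hc] at h1

/-- A continuous function on a product of compact lines has small oscillation on the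
boxes of some product of finite interval partitions. -/
theorem Continuous.exists_resolvedBy [Finite ι] [∀ l, TopologicalSpace (L l)]
    [∀ l, OrderTopology (L l)] [∀ l, CompactSpace (L l)] {g : (∀ l, L l) → ℝ}
    (hg : Continuous g) {ε : ℝ} (hε : 0 < ε) :
    ∃ B, ResolvedBy (fun p q => |g p - g q| < ε) B := by
  have key : ∀ p : ∀ l, L l, ∃ b c : ∀ l, L l,
      (Set.univ.pi fun l => Set.Icc (b l) (c l)) ∈ nhds p ∧
      ∀ q, (∀ l, q l ∈ Set.Icc (b l) (c l)) → |g q - g p| < ε / 2 := fun p => by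
    have hU : {q | |g q - g p| < ε / 2} ∈ nhds p :=
      Metric.tendsto_nhds.1 hg.continuousAt _ (half_pos hε)
    rw [nhds_pi, Filter.mem_pi] at hU
    obtain ⟨I, -, t, ht, hsub⟩ := hU
    choose b c _ hmem hbc using fun l => exists_Icc_mem_subset_of_mem_nhds (ht l)
    exact ⟨b, c, set_pi_mem_nhds Set.finite_univ fun l _ => hmem l,
      fun q hq => hsub fun l _ => hbc l (hq l)⟩
  choose b c hmem hosc using key
  obtain ⟨T, -, hT⟩ := isCompact_univ.elim_nhds_subcover _ fun p _ => hmem p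
  refine ⟨_, (ResolvedBy.forall_mem T fun a _ => resolvedBy_mem_box (b a) (c a)).mono
    (fun p q h => ?_) le_rfl⟩
  obtain ⟨a, ha, hpa⟩ := Set.mem_iUnion₂.1 (hT (Set.mem_univ p))
  have hp : ∀ l, p l ∈ Set.Icc (b a l) (c a l) := fun l => hpa l trivial
  have h1 := abs_lt.1 (hosc a p hp)
  have h2 := abs_lt.1 (hosc a q (h a ha hp))
  rw [abs_lt]
  constructor <;> linarith

end Cuts

section Separation

variable {K : Type*} [TopologicalSpace K]

theorem exists_continuousMap_eq_zero_one [CompactSpace K] [T2Space K] {x y : K} (h : x ≠ y) :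
    ∃ f : C(K, ℝ), f x = 0 ∧ f y = 1 := by
  obtain ⟨f, h0, h1, -⟩ := exists_continuous_zero_one_of_isClosed
    (isClosed_singleton (x := x)) (isClosed_singleton (x := y)) (by simpa using h)
  exact ⟨f, h0 rfl, h1 rfl⟩

theorem metrizableSpace_of_countable_separating_s12 [CompactSpace K] (G : Set C(K, ℝ))
    (hG : G.Countable) (h : ∀ x y : K, (∀ g ∈ G, g x = g y) → x = y) :
    TopologicalSpace.MetrizableSpace K := by
  have := hG.to_subtype
  let e : K → G → ℝ := fun x g => g.1 x
  have he : Continuous e := continuous_pi fun g => g.1.continuous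
  have hinj : Function.Injective e := fun x y hxy => h x y fun g hg => congrFun hxy ⟨g, hg⟩
  have := TopologicalSpace.metrizableSpace_of_t3_secondCountable (G → ℝ)
  exact (he.isClosedEmbedding hinj).isEmbedding.metrizableSpace

/-- `U` is not controlled by finitely many members of `F`: no finite subfamily decides which
pairs of points of `U` are mapped to `(0, 1)` by a member of `F`. -/
def IsRich (F : Set C(K, ℝ)) (U : Set K) : Prop :=
  ∀ G : Finset C(K, ℝ), ↑G ⊆ F → ∃ x ∈ U, ∃ y ∈ U, (∀ g ∈ G, g x = g y) ∧
    ∃ f ∈ F, f x = 0 ∧ f y = 1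

theorem IsRich.inter_le_or_inter_ge {F : Set C(K, ℝ)} {U : Set K} (hU : IsRich F U)
    {f : C(K, ℝ)} (hf : f ∈ F) (t : ℝ) :
    IsRich F (U ∩ {x | f x ≤ t}) ∨ IsRich F (U ∩ {x | t ≤ f x}) := by
  classical
  by_contra! hcon
  obtain ⟨h1, h2⟩ := hcon
  unfold IsRich at h1 h2
  push Not at h1 h2
  obtain ⟨G₁, hG₁, h1⟩ := h1
  obtain ⟨G₂, hG₂, h2⟩ := h2
  obtain ⟨x, hx, y, hy, hxy, g, hg, h0, h1'⟩ := hU (insert f (G₁ ∪ G₂)) (by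
    simp [Set.insert_subset_iff, hf, hG₁, hG₂])
  have hfxy : f x = f y := hxy f (by simp)
  rcases le_total (f x) t with h | h
  · exact h1 x ⟨hx, h⟩ y ⟨hy, hfxy.symm.trans_le h⟩ (fun g hg => hxy g (by simp [hg])) g hg h0 h1'
  · exact h2 x ⟨hx, h⟩ y ⟨hy, h.trans_eq hfxy⟩ (fun g hg => hxy g (by simp [hg])) g hg h0 h1'

/-- In a rich set, `n` functions suffice to separate some `n` points. -/
theorem IsRich.exists_separated {F : Set C(K, ℝ)} (n : ℕ) {U : Set K} (hU : IsRich F U) :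
    ∃ (A : Finset C(K, ℝ)) (Z : Finset K), ↑A ⊆ F ∧ A.card ≤ n ∧ ↑Z ⊆ U ∧ Z.card = n ∧
      ∀ x ∈ Z, ∀ y ∈ Z, x ≠ y → ∃ f ∈ A, 1 / 2 ≤ |f x - f y| := by
  classical
  induction n generalizing U with
  | zero => exact ⟨∅, ∅, by simp⟩
  | succ n ih =>
    obtain ⟨x, hx, y, hy, -, f, hf, h0, h1⟩ := hU ∅ (by simp)
    obtain ⟨V, z, hV, hVU, hz, hsep⟩ : ∃ (V : Set K) (z : K), IsRich F V ∧ V ⊆ U ∧ z ∈ U ∧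
        ∀ w ∈ V, 1 / 2 ≤ |f z - f w| := by
      rcases hU.inter_le_or_inter_ge hf (1 / 2) with h | h
      · refine ⟨_, y, h, Set.inter_subset_left, hy, fun w hw => le_abs.2 (Or.inl ?_)⟩
        have : f w ≤ 1 / 2 := hw.2
        linarith
      · refine ⟨_, x, h, Set.inter_subset_left, hx, fun w hw => le_abs.2 (Or.inr ?_)⟩
        have : 1 / 2 ≤ f w := hw.2
        linarith
    obtain ⟨A, Z, hAF, hAn, hZV, hZn, hAZ⟩ := ih hV
    have hzZ : z ∉ Z := fun hmem => by
      have := hsep z (hZV hmem)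
      norm_num at this
    refine ⟨insert f A, insert z Z, ?_, (Finset.card_insert_le _ _).trans (by omega), ?_, ?_, ?_⟩
    · simp [Set.insert_subset_iff, hf, hAF]
    · simp [Set.insert_subset_iff, hz, hZV.trans hVU]
    · rw [Finset.card_insert_of_notMem hzZ, hZn]
    · intro a ha b hb hab
      rw [Finset.mem_insert] at ha hb
      rcases ha with rfl | ha <;> rcases hb with rfl | hb
      · exact absurd rfl hab
      · exact ⟨f, by simp, hsep b (hZV hb)⟩
      · exact ⟨f, by simp, by rw [abs_sub_comm]; exact hsep a (hZV ha)⟩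
      · obtain ⟨g, hg, h⟩ := hAZ a ha b hb hab
        exact ⟨g, by simp [hg], h⟩

/-- If the continuous functions on a non-metrizable compact space are split into countably
many classes, then one class is rich. -/
theorem exists_isRich_of_not_metrizableSpace [CompactSpace K] [T2Space K]
    (hK : ¬ TopologicalSpace.MetrizableSpace K) (F : ℕ → Set C(K, ℝ))
    (hF : ∀ f, ∃ n, f ∈ F n) : ∃ n, IsRich (F n) Set.univ := by
  by_contra! hcon
  unfold IsRich at hcon
  push Not at hcon
  choose G hGF hG using hcon
  refine hK (metrizableSpace_of_countable_separating_s12 (⋃ n, (G n : Set C(K, ℝ)))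
    (Set.countable_iUnion fun n => (G n).countable_toSet) fun x y hxy => ?_)
  by_contra hne
  obtain ⟨f, h0, h1⟩ := exists_continuousMap_eq_zero_one hne
  obtain ⟨n, hn⟩ := hF f
  exact hG n x trivial y trivial
    (fun g hg => hxy g (Set.mem_iUnion.2 ⟨n, hg⟩)) f hn h0 h1

end Separation

section Images

variable {ι : Type*} {L : ι → Type*} [∀ l, LinearOrder (L l)]
  {K : Type*} [TopologicalSpace K]

theorem resolvedBy_eq_of_separated {g : (∀ l, L l) → K} {A : Finset C(K, ℝ)} {Z : Finset K}
    {B : C(K, ℝ) → ℕ} (hA : ∀ h ∈ A, ResolvedBy (fun p q => |h (g p) - h (g q)| < 1 / 2) (B h))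
    (hZ : ∀ x ∈ Z, ∀ y ∈ Z, x ≠ y → ∃ f ∈ A, 1 / 2 ≤ |f x - f y|) :
    ResolvedBy (fun p q => g p ∈ Z → g q ∈ Z → g p = g q) (∑ h ∈ A, B h) := by
  refine (ResolvedBy.forall_mem A hA).mono (fun p q h hp hq => ?_) le_rfl
  by_contra hne
  obtain ⟨f, hf, hf'⟩ := hZ _ hp _ hq hne
  exact absurd (h f hf) (not_lt.2 hf')

variable [Finite ι] [∀ l, TopologicalSpace (L l)] [∀ l, OrderTopology (L l)]
  [∀ l, CompactSpace (L l)] [CompactSpace K] [T2Space K]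

theorem exists_resolvedBy_eq {g : (∀ l, L l) → K} (hg : Continuous g) (Z : Finset K) :
    ∃ B, ResolvedBy (fun p q => g p ∈ Z → g q ∈ Z → g p = g q) B := by
  classical
  have h : ∀ a : K × K, ∃ f : C(K, ℝ), a.1 ≠ a.2 → f a.1 = 0 ∧ f a.2 = 1 := fun a => by
    by_cases ha : a.1 = a.2
    · exact ⟨0, fun h => absurd ha h⟩
    · obtain ⟨f, hf⟩ := exists_continuousMap_eq_zero_one ha
      exact ⟨f, fun _ => hf⟩
  choose F hF using h
  choose B hB using fun h : C(K, ℝ) =>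
    (h.continuous.comp hg).exists_resolvedBy (ε := 1 / 2) (by norm_num)
  refine ⟨_, resolvedBy_eq_of_separated (A := (Z ×ˢ Z).image F) (B := B) (fun h _ => hB h)
    fun x hx y hy hxy => ⟨F (x, y), Finset.mem_image_of_mem _ (by simp [hx, hy]), ?_⟩⟩
  rw [(hF (x, y) hxy).1, (hF (x, y) hxy).2]
  norm_num

/-- In a non-metrizable image, `n` points can be resolved with linearly many cuts. -/
theorem exists_resolvedBy_eq_of_not_metrizableSpace
    (hK : ¬ TopologicalSpace.MetrizableSpace K) {g : (∀ l, L l) → K} (hg : Continuous g) :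
    ∃ N : ℕ, ∀ n : ℕ, ∃ Z : Finset K, Z.card = n ∧
      ResolvedBy (fun p q => g p ∈ Z → g q ∈ Z → g p = g q) (n * N) := by
  obtain ⟨N, hN⟩ := exists_isRich_of_not_metrizableSpace hK
    (fun N => {h | ResolvedBy (fun p q => |h (g p) - h (g q)| < 1 / 2) N})
    fun h => (h.continuous.comp hg).exists_resolvedBy (by norm_num)
  refine ⟨N, fun n => ?_⟩
  obtain ⟨A, Z, hA, hAn, -, hZn, hAZ⟩ := hN.exists_separated n
  refine ⟨Z, hZn, (resolvedBy_eq_of_separated (B := fun _ => N) (fun h hh => hA hh) hAZ).mono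
    (fun _ _ h => h) ?_⟩
  simpa using Nat.mul_le_mul_right N hAn

end Images

theorem prod_card_le_of_resolvedBy {ι κ : Type*} [Fintype ι] [Fintype κ] {L : ι → Type*}
    [∀ l, LinearOrder (L l)] {K : κ → Type*} {f : (∀ l, L l) → ∀ i, K i}
    (hf : Function.Surjective f) (Z : ∀ i, Finset (K i)) (B : κ → ℕ)
    (h : ∀ i, ResolvedBy (fun p q => f p i ∈ Z i → f q i ∈ Z i → f p i = f q i) (B i)) :
    ∏ i, (Z i).card ≤ (∑ i, B i + 1) ^ Fintype.card ι := by
  classical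
  have hle := (ResolvedBy.forall_mem Finset.univ fun i _ => h i).card_le
    (κ := ∀ i, Z i) (fun z => Function.surjInv hf fun i => (z i : K i)) fun a b hab => by
      funext i
      have hi := hab i (Finset.mem_univ i)
      simp only [Function.surjInv_eq hf] at hi
      exact Subtype.ext (hi (a i).2 (b i).2)
  simpa using hle

/-- Mardešić's conjecture for `s = 1`: if a product of `d` compact lines maps
continuously onto a product of `d + 1` infinite compact Hausdorff spaces, then at least
two of the factors of the image are metrizable. -/
theorem stmt12 (d : ℕ) (hd : 1 ≤ d)
    (L : Fin d → Type*) [∀ i, LinearOrder (L i)] [∀ i, TopologicalSpace (L i)]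
    [∀ i, OrderTopology (L i)] [∀ i, CompactSpace (L i)]
    (K : Fin (d + 1) → Type*) [∀ i, TopologicalSpace (K i)] [∀ i, CompactSpace (K i)]
    [∀ i, T2Space (K i)] [∀ i, Infinite (K i)]
    (f : (∀ i, L i) → (∀ i, K i)) (hf : Continuous f)
    (hsurj : Function.Surjective f) :
    ∃ i j : Fin (d + 1), i < j ∧
      TopologicalSpace.MetrizableSpace (K i) ∧
      TopologicalSpace.MetrizableSpace (K j) := by
  by_contra hcon
  obtain ⟨i₀, hi₀⟩ : ∃ i₀ : Fin (d + 1), ∀ j : Fin d,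
      ¬ TopologicalSpace.MetrizableSpace (K (i₀.succAbove j)) := by
    by_cases hex : ∃ i, TopologicalSpace.MetrizableSpace (K i)
    · obtain ⟨i, hi⟩ := hex
      refine ⟨i, fun j hj => hcon ?_⟩
      rcases lt_or_gt_of_ne (Fin.succAbove_ne i j) with h | h
      · exact ⟨_, _, h, hj, hi⟩
      · exact ⟨_, _, h, hi, hj⟩
    · exact ⟨0, fun j hj => hex ⟨_, hj⟩⟩
  have hfc : ∀ i, Continuous fun p => f p i := fun i => (continuous_apply i).comp hf
  choose N hN using fun j => exists_resolvedBy_eq_of_not_metrizableSpace (hi₀ j) (hfc _)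
  obtain ⟨Z₀, hZ₀⟩ := Infinite.exists_subset_card_eq (K i₀) ((∑ j, N j + 1) ^ d + 1)
  obtain ⟨C, hC⟩ := exists_resolvedBy_eq (hfc i₀) Z₀
  choose Z hZ hZr using fun j => hN j (C + 1)
  have hle := prod_card_le_of_resolvedBy hsurj
    (Fin.insertNth (α := fun i => Finset (K i)) i₀ Z₀ Z)
    (Fin.insertNth (α := fun _ => ℕ) i₀ C fun j => (C + 1) * N j) fun i => by
      cases i using Fin.succAboveCases i₀ with
      | x => simpa using hC
      | p j => simpa using hZr j
  simp only [Fin.prod_univ_succAbove _ i₀, Fin.sum_univ_succAbove _ i₀, Fin.insertNth_apply_same,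
    Fin.insertNth_apply_succAbove, hZ₀, hZ, Finset.prod_const, Finset.card_univ,
    Fintype.card_fin, ← Finset.mul_sum] at hle
  have heq : C + (C + 1) * ∑ j, N j + 1 = (∑ j, N j + 1) * (C + 1) := by ring
  rw [heq, mul_pow] at hle
  have := Nat.le_of_mul_le_mul_right hle (by positivity)
  omega
end

section
/- Let d, s ≥ 1. If L1,...,Ld are compact linearly ordered topological spaces and there is a continuous surjection from L1 × ... × Ld onto a product K1 × ... × K_{d+s} of infinite compact Hausdorff spaces, then at least s+1 of the spaces K_j are metrizable. -/
open scoped Topology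

/-- Two points lie in the same cell of the partition of a chain cut by the finite set `A`. -/
def SameCell {X : Type*} [LinearOrder X] (A : Finset X) (x y : X) : Prop :=
  ∀ a ∈ A, (a < x ↔ a < y) ∧ (a ≤ x ↔ a ≤ y)

theorem SameCell.mono {X : Type*} [LinearOrder X] {A B : Finset X} (hAB : A ⊆ B) {x y : X}
    (h : SameCell B x y) : SameCell A x y :=
  fun a ha => h a (hAB ha)

/-- The position of a point relative to the finite set `A`. -/
def cellIndex {X : Type*} [LinearOrder X] (A : Finset X) (x : X) : ℕ :=
  (A.filter (· < x)).card + (A.filter (· ≤ x)).card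

theorem cellIndex_le {X : Type*} [LinearOrder X] (A : Finset X) (x : X) :
    cellIndex A x ≤ 2 * A.card := by
  have h₁ := Finset.card_filter_le A (· < x)
  have h₂ := Finset.card_filter_le A (· ≤ x)
  unfold cellIndex
  omega

theorem sameCell_of_cellIndex_eq {X : Type*} [LinearOrder X] {A : Finset X} {x y : X}
    (h : cellIndex A x = cellIndex A y) : SameCell A x y := by
  wlog hxy : x ≤ y generalizing x y
  · intro a ha
    have := this h.symm (le_of_not_ge hxy) a ha
    exact ⟨this.1.symm, this.2.symm⟩
  have s₁ : A.filter (· < x) ⊆ A.filter (· < y) :=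
    Finset.monotone_filter_right A fun a _ ha => lt_of_lt_of_le ha hxy
  have s₂ : A.filter (· ≤ x) ⊆ A.filter (· ≤ y) :=
    Finset.monotone_filter_right A fun a _ ha => le_trans ha hxy
  have c₁ := Finset.card_le_card s₁
  have c₂ := Finset.card_le_card s₂
  unfold cellIndex at h
  have e₁ := Finset.eq_of_subset_of_card_le s₁ (by omega)
  have e₂ := Finset.eq_of_subset_of_card_le s₂ (by omega)
  intro a ha
  have h₁ := congrArg (a ∈ ·) e₁
  have h₂ := congrArg (a ∈ ·) e₂
  simp only [Finset.mem_filter, ha, true_and, eq_iff_iff] at h₁ h₂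
  exact ⟨h₁, h₂⟩

/-- A continuous function on a finite product of compact chains has small oscillation on the
cells of some finite grid. -/
theorem exists_grid_abs_sub_lt {ι : Type*} [Finite ι] {L : ι → Type*} [∀ i, LinearOrder (L i)]
    [∀ i, TopologicalSpace (L i)] [∀ i, OrderTopology (L i)] [∀ i, CompactSpace (L i)]
    {F : (∀ i, L i) → ℝ} (hF : Continuous F) {ε : ℝ} (hε : 0 < ε) :
    ∃ A : ∀ i, Finset (L i), ∀ x y, (∀ i, SameCell (A i) (x i) (y i)) → |F x - F y| < ε := by
  classical
  have key : ∀ p : ∀ i, L i, ∃ U ∈ 𝓝 p, ∃ A : ∀ i, Finset (L i),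
      (∀ x ∈ U, |F x - F p| < ε / 2) ∧
      ∀ x y, (∀ i, SameCell (A i) (x i) (y i)) → x ∈ U → y ∈ U := by
    intro p
    have hs : {x | |F x - F p| < ε / 2} ∈ 𝓝 p := by
      exact hF.continuousAt.eventually (Metric.ball_mem_nhds (F p) (half_pos hε))
    rw [nhds_pi, Filter.mem_pi] at hs
    obtain ⟨I, -, t, ht, hts⟩ := hs
    choose b c _ hbc hsub using fun i => exists_Icc_mem_subset_of_mem_nhds (ht i)
    refine ⟨Set.univ.pi fun i => Set.Icc (b i) (c i), ?_, fun i => {b i, c i}, ?_, ?_⟩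
    · exact set_pi_mem_nhds Set.finite_univ fun i _ => hbc i
    · exact fun x hx => hts fun i _ => hsub i (hx i trivial)
    · intro x y hxy hx i _
      have h₁ := (hxy i (b i) (by simp)).2
      have h₂ := (hxy i (c i) (by simp)).1
      have h := hx i trivial
      exact ⟨h₁.1 h.1, not_lt.1 fun h' => not_lt.2 h.2 (h₂.2 h')⟩
  choose U hU A hA hsat using key
  obtain ⟨t, ht⟩ := CompactSpace.elim_nhds_subcover U hU
  refine ⟨fun i => t.biUnion fun p => A p i, fun x y hxy => ?_⟩
  have hx : x ∈ ⋃ p ∈ t, U p := by rw [ht]; trivial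
  simp only [Set.mem_iUnion] at hx
  obtain ⟨p, hp, hxp⟩ := hx
  have hyp := hsat p x y
    (fun i => (hxy i).mono (Finset.subset_biUnion_of_mem (fun p => A p i) hp)) hxp
  have h₁ := abs_lt.1 (hA p x hxp)
  have h₂ := abs_lt.1 (hA p y hyp)
  exact abs_lt.2 ⟨by linarith, by linarith⟩

theorem exists_continuousMap_zero_one {K : Type*} [TopologicalSpace K] [CompactSpace K]
    [T2Space K] {x y : K} (hxy : x ≠ y) : ∃ g : C(K, ℝ), g x = 0 ∧ g y = 1 := by
  obtain ⟨g, h₀, h₁, -⟩ := exists_continuous_zero_one_of_isClosed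
    (isClosed_singleton (x := x)) (isClosed_singleton (x := y)) (by simpa using hxy)
  exact ⟨g, h₀ rfl, h₁ rfl⟩

theorem metrizableSpace_of_countable_separating_s13 {K : Type*} [TopologicalSpace K]
    [CompactSpace K] {D : Set C(K, ℝ)} (hD : D.Countable)
    (hsep : ∀ x y, x ≠ y → ∃ g ∈ D, g x ≠ g y) : TopologicalSpace.MetrizableSpace K := by
  have := hD.to_subtype
  have hc : Continuous fun (x : K) (g : D) => g.1 x := by fun_prop
  refine (hc.isClosedEmbedding fun x y h => ?_).isEmbedding.metrizableSpace
  by_contra hxy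
  obtain ⟨g, hg, hne⟩ := hsep x y hxy
  exact hne (congrFun h ⟨g, hg⟩)

/-- In a nonmetrizable compact space, for any assignment of natural numbers to continuous
functions there are a sequence of functions of bounded rank and a sequence of points such that
each function separates the corresponding point from all later ones. -/
theorem exists_seq_separated {K : Type*} [TopologicalSpace K] [CompactSpace K] [T2Space K]
    (hK : ¬ TopologicalSpace.MetrizableSpace K) (rank : C(K, ℝ) → ℕ) :
    ∃ (r : ℕ) (h : ℕ → C(K, ℝ)) (z : ℕ → K), (∀ n, rank (h n) ≤ r) ∧
      ∀ m n, m < n → 1 / 2 ≤ |h m (z m) - h m (z n)| := by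
  classical
  obtain ⟨r, hr⟩ : ∃ r, ∀ s : Finset (C(K, ℝ) × K × K),
      (∀ t ∈ s, rank t.1 ≤ r ∧ t.1 t.2.1 = 0 ∧ t.1 t.2.2 = 1) →
      ∃ t : C(K, ℝ) × K × K, (rank t.1 ≤ r ∧ t.1 t.2.1 = 0 ∧ t.1 t.2.2 = 1) ∧
        ∀ u ∈ s, u.1 t.2.1 = u.1 t.2.2 := by
    by_contra! hcon
    choose s _ hs using hcon
    refine hK (metrizableSpace_of_countable_separating_s13 
      (D := ⋃ r, Prod.fst '' (s r : Set (C(K, ℝ) × K × K)))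
      (Set.countable_iUnion fun r => ((s r).finite_toSet.image _).countable) fun x y hxy => ?_)
    obtain ⟨g, hx, hy⟩ := exists_continuousMap_zero_one hxy
    obtain ⟨u, hu, hne⟩ := hs (rank g) (g, x, y) ⟨le_rfl, hx, hy⟩
    exact ⟨u.1, Set.mem_iUnion.2 ⟨rank g, u, hu, rfl⟩, hne⟩
  obtain ⟨t, ht, heq⟩ := exists_seq_of_forall_finset_exists _
    (fun u t : C(K, ℝ) × K × K => u.1 t.2.1 = u.1 t.2.2) hr
  have ramsey : ∀ R : ℕ → ℕ → Prop,
      (∀ᶠ j in (Filter.hyperfilter ℕ : Filter ℕ), ∀ᶠ i in (Filter.hyperfilter ℕ : Filter ℕ),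
        R j i) → ∃ φ : ℕ → ℕ, ∀ m n, m < n → φ m < φ n ∧ R (φ m) (φ n) := by
    intro R hR
    obtain ⟨φ, -, hφ⟩ := exists_seq_of_forall_finset_exists
      (fun j => ∀ᶠ i in (Filter.hyperfilter ℕ : Filter ℕ), R j i) (fun j i => j < i ∧ R j i)
      (fun s hs => by
        have h₁ : ∀ᶠ i in (Filter.hyperfilter ℕ : Filter ℕ), ∀ j ∈ s, j < i ∧ R j i := by
          refine (Filter.eventually_all_finset s).2 fun j hj => ?_
          refine Filter.Eventually.and ?_ (hs j hj)
          exact Nat.hyperfilter_le_atTop (Filter.eventually_gt_atTop j)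
        exact (hR.and h₁).exists)
    exact ⟨φ, hφ⟩
  rcases Ultrafilter.em (Filter.hyperfilter ℕ) fun j =>
    ∀ᶠ i in (Filter.hyperfilter ℕ : Filter ℕ), 1 / 2 ≤ (t j).1 (t i).2.1 with hR | hR
  · obtain ⟨φ, hφ⟩ := ramsey _ hR
    refine ⟨r, fun n => (t (φ n)).1, fun n => (t (φ n)).2.1, fun n => (ht _).1,
      fun m n hmn => ?_⟩
    have := (hφ m n hmn).2
    rw [(ht (φ m)).2.1, zero_sub, abs_neg]
    exact this.trans (le_abs_self _)
  · simp only [← Ultrafilter.eventually_not, not_le] at hR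
    obtain ⟨φ, hφ⟩ := ramsey _ hR
    refine ⟨r, fun n => (t (φ n)).1, fun n => (t (φ n)).2.2, fun n => (ht _).1,
      fun m n hmn => ?_⟩
    obtain ⟨hlt, h⟩ := hφ m n hmn
    have he := heq _ _ hlt
    refine le_trans ?_ (le_abs_self _)
    rw [(ht (φ m)).2.2, ← he]
    linarith

/-- Mardešić's conjecture: if a product of `d` compact lines maps continuously onto a
product of `d + s` infinite compact Hausdorff spaces, then at least `s + 1` of the
factors of the image are metrizable. -/
theorem stmt13 (d s : ℕ) (hd : 1 ≤ d) (hs : 1 ≤ s)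
    (L : Fin d → Type*) [∀ i, LinearOrder (L i)] [∀ i, TopologicalSpace (L i)]
    [∀ i, OrderTopology (L i)] [∀ i, CompactSpace (L i)]
    (K : Fin (d + s) → Type*) [∀ i, TopologicalSpace (K i)] [∀ i, CompactSpace (K i)]
    [∀ i, T2Space (K i)] [∀ i, Infinite (K i)]
    (f : (∀ i, L i) → (∀ i, K i)) (hf : Continuous f)
    (hsurj : Function.Surjective f) :
    ∃ S : Finset (Fin (d + s)), s + 1 ≤ S.card ∧
      ∀ j ∈ S, TopologicalSpace.MetrizableSpace (K j) := by
  classical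
  by_contra! hcon
  set N : Finset (Fin (d + s)) :=
    (Finset.univ.filter fun j => TopologicalSpace.MetrizableSpace (K j))ᶜ with hN
  have hNcard : d ≤ N.card := by
    have h₁ : (Finset.univ.filter fun j => TopologicalSpace.MetrizableSpace (K j)).card < s + 1 := by
      by_contra! h
      obtain ⟨j, hj, hj'⟩ := hcon _ h
      exact hj' (Finset.mem_filter.1 hj).2
    rw [hN, Finset.card_compl, Fintype.card_fin]
    omega
  obtain ⟨D, hDN, hDcard⟩ := Finset.exists_subset_card_eq hNcard
  obtain ⟨e, he⟩ : ∃ e, e ∉ D := by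
    by_contra! h
    have : D = Finset.univ := Finset.eq_univ_of_forall h
    rw [this, Finset.card_univ, Fintype.card_fin] at hDcard
    omega
  have hgrid : ∀ k (g : C(K k, ℝ)), ∃ A : ∀ i, Finset (L i), ∀ x y,
      (∀ i, SameCell (A i) (x i) (y i)) → |g (f x k) - g (f y k)| < 1 / 2 := fun k g =>
    exists_grid_abs_sub_lt (F := fun x => g (f x k)) (by fun_prop) (by norm_num)
  choose A hA using hgrid
  have hseq : ∀ k : D, ∃ (r : ℕ) (h : ℕ → C(K k, ℝ)) (z : ℕ → K k),
      (∀ n, ∑ i, (A k (h n) i).card ≤ r) ∧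
        ∀ m n, m < n → 1 / 2 ≤ |h m (z m) - h m (z n)| := fun k =>
    exists_seq_separated (by simpa [hN] using hDN k.2) fun g => ∑ i, (A k g i).card
  choose r h z hr hz using hseq
  obtain ⟨R, hR⟩ : ∃ R, R = ∑ k, r k := ⟨_, rfl⟩
  obtain ⟨M, hM⟩ : ∃ M, M = (2 * R + 1) ^ d + 1 := ⟨_, rfl⟩
  let w := Infinite.natEmbedding (K e)
  have hφ : ∀ a b : ℕ, ∃ g : C(K e, ℝ), a ≠ b → g (w a) = 0 ∧ g (w b) = 1 := fun a b => by
    by_cases hab : a = b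
    · exact ⟨0, fun h' => absurd hab h'⟩
    · obtain ⟨g, hg⟩ := exists_continuousMap_zero_one (w.injective.ne hab)
      exact ⟨g, fun _ => hg⟩
  choose φ hφ using hφ
  obtain ⟨E, hE⟩ : ∃ E : ∀ i, Finset (L i), ∀ (a b : Fin M) i, A e (φ a b) i ⊆ E i :=
    ⟨fun i => (Finset.univ : Finset (Fin M × Fin M)).biUnion fun p => A e (φ p.1 p.2) i,
      fun a b i => Finset.subset_biUnion_of_mem
        (fun p : Fin M × Fin M => A e (φ p.1 p.2) i) (Finset.mem_univ (a, b))⟩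
  obtain ⟨c, hc⟩ : ∃ c, c = ∑ i, (E i).card := ⟨_, rfl⟩
  obtain ⟨n, hn⟩ : ∃ n, n = 2 * c + 1 := ⟨_, rfl⟩
  let B : ∀ i, Finset (L i) := fun i =>
    (Finset.univ.biUnion fun k : D => (Finset.range n).biUnion fun j => A k (h k j) i) ∪ E i
  have hB : ∀ i, (B i).card ≤ n * R + c := by
    intro i
    refine (Finset.card_union_le _ _).trans (add_le_add ?_ ?_)
    · rw [hR, Finset.mul_sum]
      refine Finset.card_biUnion_le.trans (Finset.sum_le_sum fun k _ => ?_)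
      refine Finset.card_biUnion_le.trans ?_
      refine (Finset.sum_le_card_nsmul _ _ (r k) fun j _ => ?_).trans (by simp)
      exact (Finset.single_le_sum (f := fun i => (A k (h k j) i).card)
        (fun _ _ => Nat.zero_le _) (Finset.mem_univ i)).trans (hr k j)
    · rw [hc]
      exact Finset.single_le_sum (f := fun i => (E i).card)
        (fun _ _ => Nat.zero_le _) (Finset.mem_univ i)
  let P : (D → Fin n) × Fin M → ∀ k, K k := fun q =>
    Function.update
      (fun k => if hk : k ∈ D then z ⟨k, hk⟩ (q.1 ⟨k, hk⟩) else Classical.arbitrary (K k))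
      e (w q.2)
  have hPe : ∀ q, P q e = w q.2 := fun q => Function.update_self ..
  have hPD : ∀ q (k : D), P q k = z k (q.1 k) := fun q k => by
    have hne : (k : Fin (d + s)) ≠ e := fun h' => he (h' ▸ k.2)
    simp [P, Function.update_of_ne hne]
  choose σ hσ using hsurj
  have hsame : ∀ q q', (∀ i, SameCell (B i) (σ (P q) i) (σ (P q') i)) → q = q' := by
    intro q q' hqq
    refine Prod.ext (funext fun k => ?_) ?_
    · have hlt : ∀ j < n, |h k j (z k (q.1 k)) - h k j (z k (q'.1 k))| < 1 / 2 := fun j hj => by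
        have := hA k (h k j) (σ (P q)) (σ (P q')) fun i => (hqq i).mono fun a ha =>
          Finset.mem_union_left _ (Finset.mem_biUnion.2 ⟨k, Finset.mem_univ _,
            Finset.mem_biUnion.2 ⟨j, Finset.mem_range.2 hj, ha⟩⟩)
        rwa [hσ, hσ, hPD, hPD] at this
      rcases lt_trichotomy (q.1 k) (q'.1 k) with h' | h' | h'
      · exact absurd (hlt _ (q.1 k).2) (not_lt.2 (hz k _ _ h'))
      · exact h'
      · have := hlt _ (q'.1 k).2
        rw [abs_sub_comm] at this
        exact absurd this (not_lt.2 (hz k _ _ h'))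
    · by_contra hne
      have hne' : (q.2 : ℕ) ≠ q'.2 := fun h' => hne (Fin.ext h')
      have := hA e (φ q.2 q'.2) (σ (P q)) (σ (P q')) fun i => (hqq i).mono
        ((hE q.2 q'.2 i).trans Finset.subset_union_right)
      rw [hσ, hσ, hPe, hPe, (hφ _ _ hne').1, (hφ _ _ hne').2] at this
      norm_num at this
  let Φ : (D → Fin n) × Fin M → Fin d → Fin (n * (2 * R + 1)) := fun q i =>
    ⟨cellIndex (B i) (σ (P q) i), by
      have h₁ := cellIndex_le (B i) (σ (P q) i)
      have h₂ := hB i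
      have h₃ : n * (2 * R + 1) = 2 * (n * R) + n := by ring
      omega⟩
  have hΦ : Function.Injective Φ := fun q q' hq => hsame q q' fun i =>
    sameCell_of_cellIndex_eq (Fin.ext_iff.1 (congrFun hq i))
  have hcard := Fintype.card_le_of_injective Φ hΦ
  simp only [Fintype.card_prod, Fintype.card_fin, Fintype.card_fun,
    Fintype.card_coe, hDcard, mul_pow] at hcard
  have := Nat.le_of_mul_le_mul_left hcard (pow_pos (by omega) d)
  omega
end
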